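/- arXiv:1712.07604 — 2 statements merged into one kernel-verified Lean document; each statement's English description precedes it below -/
import Mathlib

section
/- There exists a constant θ₂ > 0 with the following property. For any three points x_1, x_2, x_3 ∈ ℝ³ with x_1 ≠ x_2, any number D ≥ max_{1≤i<j≤3} |x_i − x_j|, and any 0 < θ < θ₂, there exists a point x_3' ∈ ℝ³ with x_3' ≠ x_1 and x_3' ≠ x_2 such that | ((x_2 − x_1)/|x_2 − x_1|) × ((x_3' − x_1)/|x_3' − x_1|) | ≥ θ and | ((x_2 − x_1)/|x_2 − x_1|) × ((x_3' − x_2)/|x_3' − x_2|) | ≥ θ, and moreover |x_3 − x_3'| ≤ 3Dθ and max{|x_1 − x_3'|, |x_2 − x_3'|} ≤ D. The constant θ₂ is independent of the points and of D. -/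
noncomputable section

/-- The cross product of two vectors of `ℝ³` (as Euclidean space). -/
def cross3 (u v : EuclideanSpace ℝ (Fin 3)) : EuclideanSpace ℝ (Fin 3) :=
  (WithLp.equiv 2 (Fin 3 → ℝ)).symm
    ![u 1 * v 2 - u 2 * v 1, u 2 * v 0 - u 0 * v 2, u 0 * v 1 - u 1 * v 0]

/-- Lagrange's identity for `cross3`. -/
theorem norm_cross3_sq (u v : EuclideanSpace ℝ (Fin 3)) :
    ‖cross3 u v‖ ^ 2 = ‖u‖ ^ 2 * ‖v‖ ^ 2 - inner ℝ u v ^ 2 := by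
  simp [cross3, EuclideanSpace.real_norm_sq_eq, PiLp.inner_apply, Fin.sum_univ_three]
  ring

theorem inner_le_norm_cross3 {e f : EuclideanSpace ℝ (Fin 3)} (he : ‖e‖ = 1) (hf : ‖f‖ = 1)
    (hef : inner ℝ e f = 0) (w : EuclideanSpace ℝ (Fin 3)) :
    inner ℝ f w ≤ ‖cross3 e w‖ := by
  refine le_of_sq_le_sq ?_ (norm_nonneg _)
  have hproj : ‖(w - inner ℝ e w • e) - inner ℝ f w • f‖ ^ 2
      = ‖w‖ ^ 2 - inner ℝ e w ^ 2 - inner ℝ f w ^ 2 := by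
    rw [norm_sub_sq_real, norm_sub_sq_real, inner_sub_left]
    simp only [inner_smul_left, inner_smul_right, norm_smul, mul_pow, he, hf, hef,
      real_inner_comm e w, real_inner_comm f w, Real.norm_eq_abs, sq_abs, conj_trivial]
    ring
  rw [norm_cross3_sq, he]
  nlinarith [sq_nonneg ‖(w - inner ℝ e w • e) - inner ℝ f w • f‖]

/-- There is a unit vector orthogonal to `e` which makes a non-obtuse angle with `w`. -/
theorem exists_unit_orthogonal_inner_nonneg (e w : EuclideanSpace ℝ (Fin 3)) :
    ∃ f : EuclideanSpace ℝ (Fin 3), ‖f‖ = 1 ∧ inner ℝ e f = 0 ∧ 0 ≤ inner ℝ f w := by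
  have hne : (ℝ ∙ e)ᗮ ≠ ⊥ := by
    intro h
    have hsum := (ℝ ∙ e).finrank_add_finrank_orthogonal
    have hle := finrank_span_le_card (R := ℝ) {e}
    rw [Set.toFinset_card, Fintype.card_unique] at hle
    rw [h, finrank_bot, finrank_euclideanSpace_fin] at hsum
    omega
  obtain ⟨g, hg, hg0⟩ := Submodule.exists_mem_ne_zero_of_ne_bot hne
  have heg : inner ℝ e g = 0 := Submodule.mem_orthogonal_singleton_iff_inner_right.mp hg
  have hunit : ‖‖g‖⁻¹ • g‖ = 1 := norm_smul_inv_norm (𝕜 := ℝ) hg0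
  have horth : inner ℝ e (‖g‖⁻¹ • g) = 0 := by rw [inner_smul_right, heg, mul_zero]
  rcases le_total 0 (inner ℝ (‖g‖⁻¹ • g) w) with h | h
  · exact ⟨_, hunit, horth, h⟩
  · exact ⟨-(‖g‖⁻¹ • g), by rw [norm_neg, hunit], by rw [inner_neg_right, horth, neg_zero],
      by rw [inner_neg_left]; linarith⟩

/-- A vector of length at most `D` whose component along `f` is at least `θ * D` makes an angle
of sine at least `θ` with any unit vector orthogonal to `f`. -/
theorem le_norm_cross3_normalize {e f v : EuclideanSpace ℝ (Fin 3)} {θ D : ℝ} (he : ‖e‖ = 1)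
    (hf : ‖f‖ = 1) (hef : inner ℝ e f = 0) (hθ : 0 ≤ θ) (hv : v ≠ 0) (hvD : ‖v‖ ≤ D)
    (hfv : θ * D ≤ inner ℝ f v) : θ ≤ ‖cross3 e (‖v‖⁻¹ • v)‖ := by
  refine le_trans ?_ (inner_le_norm_cross3 he hf hef _)
  rw [inner_smul_right, inv_mul_eq_div, le_div_iff₀ (norm_pos_iff.mpr hv)]
  exact (mul_le_mul_of_nonneg_left hvD hθ).trans hfv

/-- Displacement of a third point so that it forms quantitatively
nonzero angles with the segment from `x₁` to `x₂`, seen from both endpoints. -/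
theorem stmt5 :
    ∃ θ₂ : ℝ, 0 < θ₂ ∧
      ∀ x₁ x₂ x₃ : EuclideanSpace ℝ (Fin 3), x₁ ≠ x₂ →
      ∀ D : ℝ,
        (∀ y ∈ ({x₁, x₂, x₃} : Set (EuclideanSpace ℝ (Fin 3))),
          ∀ z ∈ ({x₁, x₂, x₃} : Set (EuclideanSpace ℝ (Fin 3))), dist y z ≤ D) →
      ∀ θ : ℝ, 0 < θ → θ < θ₂ →
      ∃ x₃' : EuclideanSpace ℝ (Fin 3), x₃' ≠ x₁ ∧ x₃' ≠ x₂ ∧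
        θ ≤ ‖cross3 (‖x₂ - x₁‖⁻¹ • (x₂ - x₁)) (‖x₃' - x₁‖⁻¹ • (x₃' - x₁))‖ ∧
        θ ≤ ‖cross3 (‖x₂ - x₁‖⁻¹ • (x₂ - x₁)) (‖x₃' - x₂‖⁻¹ • (x₃' - x₂))‖ ∧
        dist x₃ x₃' ≤ 3 * D * θ ∧
        dist x₁ x₃' ≤ D ∧ dist x₂ x₃' ≤ D := by
  refine ⟨1 / 2, by norm_num, fun x₁ x₂ x₃ hne D hD θ hθ hθ₂ ↦ ?_⟩
  have h12 : dist x₁ x₂ ≤ D := hD _ (by simp) _ (by simp)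
  have h13 : dist x₁ x₃ ≤ D := hD _ (by simp) _ (by simp)
  have h23 : dist x₂ x₃ ≤ D := hD _ (by simp) _ (by simp)
  have hDpos : 0 < D := (dist_pos.mpr hne).trans_le h12
  set e := ‖x₂ - x₁‖⁻¹ • (x₂ - x₁) with he_def
  have hsub : x₂ - x₁ ≠ 0 := sub_ne_zero.mpr hne.symm
  have he : ‖e‖ = 1 := norm_smul_inv_norm (𝕜 := ℝ) hsub
  obtain ⟨f, hf, hef, hf3⟩ := exists_unit_orthogonal_inner_nonneg e (x₃ - x₁)
  have hf12 : inner ℝ f (x₂ - x₁) = 0 := by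
    rw [he_def, inner_smul_left, mul_eq_zero] at hef
    rw [real_inner_comm]
    exact hef.resolve_left (by simpa using hsub)
  set m := midpoint ℝ x₁ x₂ with hm
  set p := m + (D / 2) • f with hp
  have hmp : dist m p = D / 2 := by
    rw [hp, dist_self_add_right, norm_smul, hf, Real.norm_of_nonneg (by positivity), mul_one]
  have hm1 : dist x₁ m ≤ D / 2 := by
    rw [hm, dist_left_midpoint, Real.norm_ofNat]; linarith
  have hm2 : dist x₂ m ≤ D / 2 := by
    rw [hm, dist_right_midpoint, Real.norm_ofNat]; linarith
  have hp1 : dist x₁ p ≤ D := by linarith [dist_triangle x₁ m p]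
  have hp2 : dist x₂ p ≤ D := by linarith [dist_triangle x₂ m p]
  have hm3 : dist x₃ m ≤ D := by
    have := (convex_closedBall x₃ D).midpoint_mem (x := x₁) (y := x₂)
      (Metric.mem_closedBall.mpr h13) (Metric.mem_closedBall.mpr h23)
    rwa [dist_comm]
  have hp3 : dist x₃ p ≤ 3 / 2 * D := by linarith [dist_triangle x₃ m p]
  set q := AffineMap.lineMap x₃ p (2 * θ) with hq
  have hball : ∀ c, dist c x₃ ≤ D → dist c p ≤ D → dist c q ≤ D := by
    intro c hc hc'
    rw [dist_comm] at hc hc' ⊢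
    exact (convex_closedBall c D).lineMap_mem (Metric.mem_closedBall.mpr hc)
      (Metric.mem_closedBall.mpr hc') ⟨by linarith, by linarith⟩
  have hq1 := hball x₁ h13 hp1
  have hq2 := hball x₂ h23 hp2
  have hpf : inner ℝ f (p - x₁) = D / 2 := by
    have : p - x₁ = (1 / 2 : ℝ) • (x₂ - x₁) + (D / 2) • f := by
      rw [hp, hm, midpoint_eq_smul_add, invOf_eq_inv]
      module
    rw [this, inner_add_right, inner_smul_right, inner_smul_right, hf12,
      real_inner_self_eq_norm_sq, hf]
    ring
  have hqf1 : θ * D ≤ inner ℝ f (q - x₁) := by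
    have : q - x₁ = (1 - 2 * θ) • (x₃ - x₁) + (2 * θ) • (p - x₁) := by
      rw [hq, AffineMap.lineMap_apply_module]
      module
    rw [this, inner_add_right, inner_smul_right, inner_smul_right, hpf]
    nlinarith [mul_nonneg (by linarith : 0 ≤ 1 - 2 * θ) hf3]
  have hqf2 : θ * D ≤ inner ℝ f (q - x₂) := by
    rwa [← sub_sub_sub_cancel_right q x₂ x₁, inner_sub_right, hf12, sub_zero]
  have hθD : 0 < θ * D := mul_pos hθ hDpos
  have hne1 : q - x₁ ≠ 0 := by
    intro h; rw [h, inner_zero_right] at hqf1; linarith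
  have hne2 : q - x₂ ≠ 0 := by
    intro h; rw [h, inner_zero_right] at hqf2; linarith
  refine ⟨q, sub_ne_zero.mp hne1, sub_ne_zero.mp hne2,
    le_norm_cross3_normalize he hf hef hθ.le hne1 (by rwa [← dist_eq_norm']) hqf1,
    le_norm_cross3_normalize he hf hef hθ.le hne2 (by rwa [← dist_eq_norm']) hqf2, ?_, hq1, hq2⟩
  rw [hq, dist_left_lineMap, Real.norm_of_nonneg (by positivity)]
  nlinarith
end
end

section
/- There is a universal constant C > 0 with the following property. Let Ω ⊂ ℝ³ be a bounded open set, let ε > 0, α ∈ (0,1), and let u ∈ C¹(Ω̄, ℂ), A ∈ C¹(Ω̄, ℝ³). Define T := { t ∈ [5/8, 3/4] : ℋ²({x ∈ Ω : |u(x)| = t}) ≤ ε^α }. Then the Lebesgue measure of T satisfies |T| ≥ 1/8 − C ε^{1−α} F_ε(u,A). -/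
open MeasureTheory
open scoped BigOperators

noncomputable section

/-- Partial derivative in the `k`-th coordinate direction of a scalar function on `ℝ³`. -/
def pderiv3 (f : EuclideanSpace ℝ (Fin 3) → ℝ) (k : Fin 3)
    (x : EuclideanSpace ℝ (Fin 3)) : ℝ :=
  fderiv ℝ f x (EuclideanSpace.single k 1)

/-- The curl of a vector field on `ℝ³`. -/
def curl3 (A : EuclideanSpace ℝ (Fin 3) → EuclideanSpace ℝ (Fin 3))
    (x : EuclideanSpace ℝ (Fin 3)) : EuclideanSpace ℝ (Fin 3) :=
  (WithLp.equiv 2 (Fin 3 → ℝ)).symm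
    ![pderiv3 (fun y => A y 2) 1 x - pderiv3 (fun y => A y 1) 2 x,
      pderiv3 (fun y => A y 0) 2 x - pderiv3 (fun y => A y 2) 0 x,
      pderiv3 (fun y => A y 1) 0 x - pderiv3 (fun y => A y 0) 1 x]

/-- The Ginzburg–Landau free energy
`F_ε(u,A) = (1/2)∫_Ω |∇u − iAu|² + (1/(2ε²))(1 − |u|²)² + |curl A|²`. -/
def freeEnergy3 (ε : ℝ) (u : EuclideanSpace ℝ (Fin 3) → ℂ)
    (A : EuclideanSpace ℝ (Fin 3) → EuclideanSpace ℝ (Fin 3))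
    (Ω : Set (EuclideanSpace ℝ (Fin 3))) : ℝ :=
  (1 / 2) * ∫ x in Ω,
    ((∑ k : Fin 3, ‖fderiv ℝ u x (EuclideanSpace.single k 1)
        - Complex.I * (A x k : ℂ) * u x‖ ^ 2)
      + (1 / (2 * ε ^ 2)) * (1 - ‖u x‖ ^ 2) ^ 2 + ‖curl3 A x‖ ^ 2)

open Filter Set Metric Topology
open scoped ENNReal NNReal

/-- Eilenberg's inequality for a real-valued Lipschitz function on a set of finite measure, with the
upper integral expressed through a measurable majorant. -/
theorem exists_measurable_hausdorffMeasure_fiber_le_of_lipschitzOnWith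
    {X : Type*} [MetricSpace X] [MeasurableSpace X] [BorelSpace X] {d : ℝ} (hd : 0 < d)
    {f : X → ℝ} {c : ℝ≥0} {s : Set X} (hf : LipschitzOnWith c f s) (hs : μH[d + 1] s ≠ ∞) :
    ∃ g : ℝ → ℝ≥0∞, Measurable g ∧ (∀ t, μH[d] (s ∩ f ⁻¹' {t}) ≤ g t) ∧
      ∫⁻ t, g t ≤ c * μH[d + 1] s := by
  have hd1 : 0 < d + 1 := by linarith
  set r : ℕ → ℝ≥0∞ := fun n => (n : ℝ≥0∞)⁻¹
  have hr : Tendsto r atTop (𝓝 0) := ENNReal.tendsto_inv_nat_nhds_zero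
  have hr0 : ∀ n, 0 < r n := fun n => by simp [r]
  have hcover : ∀ n, ∃ E : ℕ → Set X, s ⊆ ⋃ i, E i ∧ (∀ i, ediam (E i) ≤ r n) ∧
      (∀ i, E i ⊆ s) ∧ ∑' i, ediam (E i) ^ (d + 1) ≤ μH[d + 1] s + r n := by
    intro n
    have h1 : (⨅ (E : ℕ → Set X) (_ : s ⊆ ⋃ i, E i) (_ : ∀ i, ediam (E i) ≤ r n),
        ∑' i, ⨆ _ : (E i).Nonempty, ediam (E i) ^ (d + 1)) < μH[d + 1] s + r n := by
      refine lt_of_le_of_lt ?_ (ENNReal.lt_add_right hs (hr0 n).ne')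
      rw [Measure.hausdorffMeasure_apply]
      exact le_iSup₂_of_le (r n) (hr0 n) le_rfl
    simp only [iInf_lt_iff] at h1
    obtain ⟨E, hE, hEr, hsum⟩ := h1
    refine ⟨fun i => E i ∩ s, ?_, fun i => (ediam_mono inter_subset_left).trans (hEr i),
      fun i => inter_subset_right, le_trans (ENNReal.tsum_le_tsum fun i => ?_) hsum.le⟩
    · rw [← iUnion_inter]
      exact subset_inter hE Subset.rfl
    · rcases (E i).eq_empty_or_nonempty with h | h
      · simp [h, hd1]
      · simp only [h, iSup_pos]
        exact ENNReal.rpow_le_rpow (ediam_mono inter_subset_left) hd1.le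
  choose E hE hEr hEs hEsum using hcover
  set g : ℕ → ℝ → ℝ≥0∞ := fun n t =>
    ∑' i, (closure (f '' E n i)).indicator (fun _ => ediam (E n i) ^ d) t
  have hg : ∀ n, Measurable (g n) := fun n =>
    Measurable.tsum fun i => measurable_const.indicator isClosed_closure.measurableSet
  refine ⟨fun t => liminf (fun n => g n t) atTop, .liminf hg, fun t => ?_, ?_⟩
  · refine (Measure.hausdorffMeasure_le_liminf_tsum d _ r hr (fun n i => E n i ∩ f ⁻¹' {t})
      (.of_forall fun n i => (ediam_mono inter_subset_left).trans (hEr n i))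
      (.of_forall fun n => ?_)).trans ?_
    · rw [← iUnion_inter]
      exact inter_subset_inter_left _ (hE n)
    · refine liminf_le_liminf (.of_forall fun n => ENNReal.tsum_le_tsum fun i => ?_)
      rcases (E n i ∩ f ⁻¹' {t}).eq_empty_or_nonempty with h | ⟨x, hx, hxt⟩
      · simp [h, hd]
      · rw [indicator_of_mem (show t ∈ closure (f '' E n i) from subset_closure ⟨x, hx, hxt⟩)]
        exact ENNReal.rpow_le_rpow (ediam_mono inter_subset_left) hd.le
  · have hint : ∀ n, ∫⁻ t, g n t ≤ c * (μH[d + 1] s + r n) := by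
      intro n
      rw [lintegral_tsum fun i =>
        (measurable_const.indicator isClosed_closure.measurableSet).aemeasurable]
      refine le_trans ?_ (mul_le_mul_right (hEsum n) _)
      rw [← ENNReal.tsum_mul_left]
      refine ENNReal.tsum_le_tsum fun i => ?_
      rw [lintegral_indicator_const isClosed_closure.measurableSet]
      have hvol : volume (closure (f '' E n i)) ≤ c * ediam (E n i) := by
        refine (Real.volume_le_diam _).trans ?_
        rw [ediam_closure, ediam_image_le_iff]
        intro x hx y hy
        exact (hf (hEs n i hx) (hEs n i hy)).trans
          (mul_le_mul_right (edist_le_ediam_of_mem hx hy) _)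
      calc ediam (E n i) ^ d * volume (closure (f '' E n i))
          ≤ ediam (E n i) ^ d * (c * ediam (E n i)) := by gcongr
        _ = c * ediam (E n i) ^ (d + 1) := by
            rw [ENNReal.rpow_add_of_nonneg _ _ hd.le zero_le_one, ENNReal.rpow_one]
            ring
    refine (lintegral_liminf_le hg).trans ?_
    refine (liminf_le_liminf (.of_forall hint)).trans (le_of_eq ?_)
    refine Tendsto.liminf_eq ?_
    have : Tendsto (fun n => c * (μH[d + 1] s + r n)) atTop (𝓝 (c * (μH[d + 1] s + 0))) :=
      ENNReal.Tendsto.const_mul (tendsto_const_nhds.add hr) (.inr ENNReal.coe_ne_top)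
    simpa using this

/-- Eilenberg's inequality for a function whose local Lipschitz constant is dominated by `h`. -/
theorem exists_measurable_hausdorffMeasure_fiber_le_lintegral
    {X : Type*} [MetricSpace X] [MeasurableSpace X] [BorelSpace X] [SecondCountableTopology X]
    {d : ℝ} (hd : 0 < d) {f : X → ℝ} {h : X → ℝ≥0∞} {s : Set X} (hs : MeasurableSet s)
    (hfin : μH[d + 1] s ≠ ∞)
    (hf : ∀ x ∈ s, ∃ U ∈ 𝓝 x, ∃ c : ℝ≥0, LipschitzOnWith c f U ∧ ∀ y ∈ U, (c : ℝ≥0∞) ≤ h y) :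
    ∃ g : ℝ → ℝ≥0∞, Measurable g ∧ (∀ t, μH[d] (s ∩ f ⁻¹' {t}) ≤ g t) ∧
      ∫⁻ t, g t ≤ ∫⁻ x in s, h x ∂μH[d + 1] := by
  rcases s.eq_empty_or_nonempty with rfl | hne
  · exact ⟨0, measurable_zero, by simp, by simp⟩
  choose! U hU c hc hch using hf
  obtain ⟨T, hTs, hTc, hT⟩ := TopologicalSpace.countable_cover_nhdsWithin
    (f := fun x => interior (U x)) (s := s) fun x hx => mem_nhdsWithin_of_mem_nhds (interior_mem_nhds.2 (hU x hx))
  have hTne : T.Nonempty := by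
    rw [nonempty_iff_ne_empty]
    rintro rfl
    simp at hT
    exact hne.ne_empty hT
  obtain ⟨p, hp⟩ := hTc.exists_eq_range hTne
  have hps : ∀ n, p n ∈ s := fun n => hTs (hp ▸ mem_range_self n)
  set P : ℕ → Set X := disjointed fun n => s ∩ interior (U (p n))
  have hPm : ∀ n, MeasurableSet (P n) :=
    MeasurableSet.disjointed fun n => hs.inter isOpen_interior.measurableSet
  have hPsub : ∀ n, P n ⊆ s ∩ interior (U (p n)) := fun n => disjointed_subset _ n
  have hPU : ∀ n, P n ⊆ U (p n) := fun n x hx => interior_subset (hPsub n hx).2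
  have hPun : ⋃ n, P n = s := by
    rw [iUnion_disjointed, ← inter_iUnion, inter_eq_left]
    rw [hp, biUnion_range] at hT
    exact hT
  have key : ∀ n, ∃ g : ℝ → ℝ≥0∞, Measurable g ∧ (∀ t, μH[d] (P n ∩ f ⁻¹' {t}) ≤ g t) ∧
      ∫⁻ t, g t ≤ c (p n) * μH[d + 1] (P n) := fun n =>
    exists_measurable_hausdorffMeasure_fiber_le_of_lipschitzOnWith hd
      ((hc _ (hps n)).mono (hPU n))
      (measure_ne_top_of_subset (fun x hx => (hPsub n hx).1) hfin)
  choose g hgm hg hgi using key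
  refine ⟨fun t => ∑' n, g n t, .tsum hgm, fun t => ?_, ?_⟩
  · conv_lhs => rw [← hPun, iUnion_inter]
    exact (measure_iUnion_le _).trans (ENNReal.tsum_le_tsum fun n => hg n t)
  · rw [lintegral_tsum fun n => (hgm n).aemeasurable]
    conv_rhs => rw [← hPun]
    rw [lintegral_iUnion hPm (disjoint_disjointed _)]
    refine ENNReal.tsum_le_tsum fun n => (hgi n).trans ?_
    rw [← setLIntegral_const]
    exact setLIntegral_mono' (hPm n) fun x hx => hch _ (hps n) x (hPU n hx)

/-- On the closure of a bounded open set, the derivative of a `C¹` function is bounded. -/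
theorem ContDiffOn.exists_norm_fderiv_le_of_isBounded
    {E F : Type*} [NormedAddCommGroup E] [NormedSpace ℝ E] [ProperSpace E]
    [NormedAddCommGroup F] [NormedSpace ℝ F] {f : E → F} {s : Set E}
    (hf : ContDiffOn ℝ 1 f (closure s)) (hs : IsOpen s) (hb : Bornology.IsBounded s) :
    ∃ M : ℝ, ∀ x ∈ s, ‖fderiv ℝ f x‖ ≤ M := by
  suffices ∃ M : ℝ, ∀ x ∈ closure s, x ∈ s → ‖fderiv ℝ f x‖ ≤ M by
    obtain ⟨M, hM⟩ := this
    exact ⟨M, fun x hx => hM x (subset_closure hx) hx⟩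
  refine hb.isCompact_closure.induction_on
    (p := fun t => ∃ M : ℝ, ∀ x ∈ t, x ∈ s → ‖fderiv ℝ f x‖ ≤ M) ⟨0, by simp⟩
    (fun a b hab ⟨M, hM⟩ => ⟨M, fun x hx => hM x (hab hx)⟩)
    (fun a b ⟨M, hM⟩ ⟨N, hN⟩ => ⟨max M N, ?_⟩) ?_
  · rintro x (hx | hx) hxs
    · exact (hM x hx hxs).trans (le_max_left _ _)
    · exact (hN x hx hxs).trans (le_max_right _ _)
  · intro x hx
    have h := hf x hx
    rw [← zero_add (1 : WithTop ℕ∞), contDiffWithinAt_succ_iff_hasFDerivWithinAt (by simp),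
      insert_eq_of_mem hx] at h
    obtain ⟨v, hv, -, f', hf', hcont⟩ := h
    have hbd : ∀ᶠ y in 𝓝[v] x, ‖f' y‖ < ‖f' x‖ + 1 :=
      hcont.continuousWithinAt.norm.eventually_lt_const (by linarith)
    have hbd' : ∀ᶠ y in 𝓝[closure s] x, ‖f' y‖ < ‖f' x‖ + 1 :=
      nhdsWithin_le_of_mem hv hbd
    obtain ⟨O, hO, hxO, hOv⟩ := mem_nhdsWithin.1 (inter_mem hv hbd')
    refine ⟨O ∩ closure s,
      inter_mem (mem_nhdsWithin_of_mem_nhds (hO.mem_nhds hxO)) self_mem_nhdsWithin,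
      ‖f' x‖ + 1, fun y hy hys => ?_⟩
    have hvy : v ∈ 𝓝 y := by
      filter_upwards [hO.mem_nhds hy.1, hs.mem_nhds hys] with z hz hzs
      exact (hOv ⟨hz, subset_closure hzs⟩).1
    rw [((hf' y (hOv hy).1).hasFDerivAt hvy).fderiv]
    exact (hOv hy).2.le

/-- Diamagnetic inequality: the derivative of `‖u‖` is bounded by the covariant derivative of `u`. -/
theorem HasStrictFDerivAt.exists_norm_le_sum_covariant {ι : Type*} [Fintype ι] [DecidableEq ι]
    {u : EuclideanSpace ℝ ι → ℂ} {L : EuclideanSpace ℝ ι →L[ℝ] ℂ} {x : EuclideanSpace ℝ ι}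
    (hu : HasStrictFDerivAt u L x) (hx : u x ≠ 0) (a : ι → ℝ) :
    ∃ L' : EuclideanSpace ℝ ι →L[ℝ] ℝ, HasStrictFDerivAt (fun y => ‖u y‖) L' x ∧
      ‖L'‖ ≤ ∑ k, ‖L (EuclideanSpace.single k 1) - Complex.I * (a k : ℂ) * u x‖ := by
  have hn : 0 < ‖u x‖ := norm_pos_iff.2 hx
  have h1 := ((hasStrictFDerivAt_norm_sq (u x)).comp x hu).sqrt
    (by simpa using hx)
  simp only [Real.sqrt_sq (norm_nonneg _)] at h1
  refine ⟨_, h1, ContinuousLinearMap.opNorm_le_bound _ (by positivity) fun v => ?_⟩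
  set L' : EuclideanSpace ℝ ι →L[ℝ] ℝ := (1 / (2 * ‖u x‖)) • (2 • innerSL ℝ (u x)).comp L with hL'
  have hbasis : ∀ k, |L' (EuclideanSpace.single k 1)| ≤
      ‖L (EuclideanSpace.single k 1) - Complex.I * (a k : ℂ) * u x‖ := by
    intro k
    have horth : Inner.inner ℝ (u x) (Complex.I * (a k : ℂ) * u x) = 0 := by
      simp [Complex.inner]
      ring
    have hval : L' (EuclideanSpace.single k 1) =
        Inner.inner ℝ (u x) (L (EuclideanSpace.single k 1) - Complex.I * (a k : ℂ) * u x) /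
          ‖u x‖ := by
      rw [inner_sub_right, horth, sub_zero, hL']
      simp
      field_simp
    rw [hval, abs_div, abs_norm, div_le_iff₀ hn]
    exact (abs_real_inner_le_norm _ _).trans_eq (mul_comm _ _)
  have hv : L' v = ∑ k, v k * L' (EuclideanSpace.single k 1) := by
    conv_lhs => rw [← (EuclideanSpace.basisFun ι ℝ).sum_repr v]
    simp [map_sum]
  rw [hv, Finset.sum_mul]
  refine (norm_sum_le _ _).trans (Finset.sum_le_sum fun k _ => ?_)
  rw [norm_mul, mul_comm]
  exact mul_le_mul (hbasis k) (PiLp.norm_apply_le v k) (norm_nonneg _) (norm_nonneg _)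

/-- The integrand of the Ginzburg–Landau free energy. -/
def energyDensity3 (ε : ℝ) (u : EuclideanSpace ℝ (Fin 3) → ℂ)
    (A : EuclideanSpace ℝ (Fin 3) → EuclideanSpace ℝ (Fin 3)) (x : EuclideanSpace ℝ (Fin 3)) : ℝ :=
  (∑ k : Fin 3, ‖fderiv ℝ u x (EuclideanSpace.single k 1)
      - Complex.I * (A x k : ℂ) * u x‖ ^ 2)
    + (1 / (2 * ε ^ 2)) * (1 - ‖u x‖ ^ 2) ^ 2 + ‖curl3 A x‖ ^ 2

theorem energyDensity3_nonneg (ε : ℝ) (u : EuclideanSpace ℝ (Fin 3) → ℂ)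
    (A : EuclideanSpace ℝ (Fin 3) → EuclideanSpace ℝ (Fin 3)) (x : EuclideanSpace ℝ (Fin 3)) :
    0 ≤ energyDensity3 ε u A x := by
  unfold energyDensity3
  positivity

theorem pderiv3_apply {A : EuclideanSpace ℝ (Fin 3) → EuclideanSpace ℝ (Fin 3)}
    {x : EuclideanSpace ℝ (Fin 3)} (hA : DifferentiableAt ℝ A x) (i k : Fin 3) :
    pderiv3 (fun y => A y i) k x = fderiv ℝ A x (EuclideanSpace.single k 1) i := by
  have h : HasFDerivAt (fun y => A y i)
      ((EuclideanSpace.proj i : EuclideanSpace ℝ (Fin 3) →L[ℝ] ℝ).comp (fderiv ℝ A x)) x :=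
    (EuclideanSpace.proj i : EuclideanSpace ℝ (Fin 3) →L[ℝ] ℝ).hasFDerivAt.comp x hA.hasFDerivAt
  rw [pderiv3, h.fderiv]
  rfl

/-- For fields that are `C¹` up to the boundary of a bounded open set, the energy density is
continuous and integrable. -/
theorem continuousOn_and_integrableOn_energyDensity3 {Ω : Set (EuclideanSpace ℝ (Fin 3))}
    (hΩ : IsOpen Ω) (hb : Bornology.IsBounded Ω) (ε : ℝ)
    {u : EuclideanSpace ℝ (Fin 3) → ℂ} {A : EuclideanSpace ℝ (Fin 3) → EuclideanSpace ℝ (Fin 3)}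
    (hu : ContDiffOn ℝ 1 u (closure Ω)) (hA : ContDiffOn ℝ 1 A (closure Ω)) :
    ContinuousOn (energyDensity3 ε u A) Ω ∧ IntegrableOn (energyDensity3 ε u A) Ω := by
  have hu' := hu.mono subset_closure
  have hA' := hA.mono subset_closure
  have hdA : ∀ x ∈ Ω, DifferentiableAt ℝ A x := fun x hx =>
    (hA'.contDiffAt (hΩ.mem_nhds hx)).differentiableAt one_ne_zero
  let G : ℂ × (EuclideanSpace ℝ (Fin 3) →L[ℝ] ℂ) × EuclideanSpace ℝ (Fin 3) ×
      (EuclideanSpace ℝ (Fin 3) →L[ℝ] EuclideanSpace ℝ (Fin 3)) → ℝ := fun p =>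
    (∑ k : Fin 3, ‖p.2.1 (EuclideanSpace.single k 1)
        - Complex.I * (p.2.2.1 k : ℂ) * p.1‖ ^ 2)
      + (1 / (2 * ε ^ 2)) * (1 - ‖p.1‖ ^ 2) ^ 2 +
      ((p.2.2.2 (EuclideanSpace.single 1 1) 2 - p.2.2.2 (EuclideanSpace.single 2 1) 1) ^ 2 +
       (p.2.2.2 (EuclideanSpace.single 2 1) 0 - p.2.2.2 (EuclideanSpace.single 0 1) 2) ^ 2 +
       (p.2.2.2 (EuclideanSpace.single 0 1) 1 - p.2.2.2 (EuclideanSpace.single 1 1) 0) ^ 2)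
  have hG : Continuous G := by fun_prop
  have heq : EqOn (energyDensity3 ε u A) (fun x => G (u x, fderiv ℝ u x, A x, fderiv ℝ A x)) Ω := by
    intro x hx
    simp [energyDensity3, G, curl3, EuclideanSpace.real_norm_sq_eq, Fin.sum_univ_three,
      pderiv3_apply (hdA x hx)]
  have hcont : ContinuousOn (energyDensity3 ε u A) Ω :=
    (hG.comp_continuousOn (hu'.continuousOn.prodMk
      ((hu'.continuousOn_fderiv_of_isOpen hΩ le_rfl).prodMk
        (hA'.continuousOn.prodMk (hA'.continuousOn_fderiv_of_isOpen hΩ le_rfl))))).congr heq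
  refine ⟨hcont, ?_⟩
  obtain ⟨M, hM⟩ := hu.exists_norm_fderiv_le_of_isBounded hΩ hb
  obtain ⟨N, hN⟩ := hA.exists_norm_fderiv_le_of_isBounded hΩ hb
  have hK : IsCompact ((u '' closure Ω) ×ˢ closedBall (0 : EuclideanSpace ℝ (Fin 3) →L[ℝ] ℂ) M ×ˢ
      (A '' closure Ω) ×ˢ
      closedBall (0 : EuclideanSpace ℝ (Fin 3) →L[ℝ] EuclideanSpace ℝ (Fin 3)) N) :=
    (hb.isCompact_closure.image_of_continuousOn hu.continuousOn).prod
      ((isCompact_closedBall _ _).prod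
        ((hb.isCompact_closure.image_of_continuousOn hA.continuousOn).prod
          (isCompact_closedBall _ _)))
  obtain ⟨R, hR⟩ := hK.exists_bound_of_continuousOn hG.continuousOn
  refine ⟨hcont.aestronglyMeasurable hΩ.measurableSet,
    .restrict_of_bounded (C := R) hb.measure_lt_top ?_⟩
  filter_upwards [ae_restrict_mem hΩ.measurableSet] with x hx
  rw [heq hx]
  exact hR _ ⟨mem_image_of_mem _ (subset_closure hx), by simpa using hM x hx,
    mem_image_of_mem _ (subset_closure hx), by simpa using hN x hx⟩

theorem sum_lt_mul_energyDensity3 {ε : ℝ} (hε : 0 < ε) {u : EuclideanSpace ℝ (Fin 3) → ℂ}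
    {x : EuclideanSpace ℝ (Fin 3)} (hx : ‖u x‖ < 4 / 5)
    (A : EuclideanSpace ℝ (Fin 3) → EuclideanSpace ℝ (Fin 3)) :
    ∑ k : Fin 3, ‖fderiv ℝ u x (EuclideanSpace.single k 1) - Complex.I * (A x k : ℂ) * u x‖
      < 20 * ε * energyDensity3 ε u A x := by
  unfold energyDensity3
  set a : Fin 3 → ℝ := fun k =>
    ‖fderiv ℝ u x (EuclideanSpace.single k 1) - Complex.I * (A x k : ℂ) * u x‖
  have hyoung : ∀ k, a k ≤ ε * a k ^ 2 + 1 / (4 * ε) := by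
    intro k
    have : ε * a k ^ 2 + 1 / (4 * ε) - a k = (2 * ε * a k - 1) ^ 2 / (4 * ε) := by
      field_simp
      ring
    have : 0 ≤ (2 * ε * a k - 1) ^ 2 / (4 * ε) := by positivity
    linarith
  have hsum : ∑ k, a k ≤ ε * ∑ k, a k ^ 2 + 3 / (4 * ε) := by
    refine (Finset.sum_le_sum fun k _ => hyoung k).trans (le_of_eq ?_)
    rw [Finset.sum_add_distrib, ← Finset.mul_sum]
    simp
    ring
  have hpot : 9 / 25 < 1 - ‖u x‖ ^ 2 := by nlinarith [norm_nonneg (u x)]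
  have hpot2 : 3 / (4 * ε) < 20 * ε * ((1 / (2 * ε ^ 2)) * (1 - ‖u x‖ ^ 2) ^ 2) := by
    have : 20 * ε * ((1 / (2 * ε ^ 2)) * (1 - ‖u x‖ ^ 2) ^ 2) =
        (40 * (1 - ‖u x‖ ^ 2) ^ 2) / (4 * ε) := by
      field_simp
      ring
    rw [this]
    gcongr
    nlinarith
  have h1 : 0 ≤ ∑ k, a k ^ 2 := by positivity
  have h2 : 0 ≤ 20 * ε * ‖curl3 A x‖ ^ 2 := by positivity
  have h3 : 0 ≤ ε * ∑ k, a k ^ 2 := by positivity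
  calc ∑ k, a k ≤ ε * ∑ k, a k ^ 2 + 3 / (4 * ε) := hsum
    _ < 20 * (ε * ∑ k, a k ^ 2) + 20 * ε * ((1 / (2 * ε ^ 2)) * (1 - ‖u x‖ ^ 2) ^ 2)
        + 20 * ε * ‖curl3 A x‖ ^ 2 := by linarith
    _ = _ := by ring

/-- The set of levels `t ∈ [5/8, 3/4]` whose level surface
`{|u| = t}` has small area has Lebesgue measure at least `1/8 − C ε^{1−α} F_ε(u,A)`. -/
theorem stmt18 :
    ∃ C : ℝ, 0 < C ∧
      ∀ Ω : Set (EuclideanSpace ℝ (Fin 3)), IsOpen Ω → Bornology.IsBounded Ω →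
      ∀ ε α : ℝ, 0 < ε → 0 < α → α < 1 →
      ∀ (u : EuclideanSpace ℝ (Fin 3) → ℂ)
        (A : EuclideanSpace ℝ (Fin 3) → EuclideanSpace ℝ (Fin 3)),
        ContDiffOn ℝ 1 u (closure Ω) → ContDiffOn ℝ 1 A (closure Ω) →
        ENNReal.ofReal (1 / 8 - C * ε ^ (1 - α) * freeEnergy3 ε u A Ω) ≤
          volume {t : ℝ | t ∈ Set.Icc (5 / 8 : ℝ) (3 / 4) ∧
            μH[2] {x ∈ Ω | ‖u x‖ = t} ≤ ENNReal.ofReal (ε ^ α)} := by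
  obtain ⟨κ, hκ⟩ : ∃ κ : ℝ≥0, (μH[2 + 1] : Measure (EuclideanSpace ℝ (Fin 3))) = κ • volume := by
    have hH : (μH[2 + 1] : Measure (EuclideanSpace ℝ (Fin 3))).IsAddHaarMeasure := by
      have := isAddHaarMeasure_hausdorffMeasure (E := EuclideanSpace ℝ (Fin 3))
      have h3 : ((Module.finrank ℝ (EuclideanSpace ℝ (Fin 3)) : ℕ) : ℝ) = 2 + 1 := by
        norm_num
      rwa [h3] at this
    exact ⟨_, Measure.isAddLeftInvariant_eq_smul _ _⟩
  refine ⟨40 * κ + 1, by positivity, fun Ω hΩ hb ε α hε _ _ u A hu hA => ?_⟩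
  obtain ⟨hcont, hint⟩ := continuousOn_and_integrableOn_energyDensity3 hΩ hb ε hu hA
  have hu' := hu.mono subset_closure
  set F := freeEnergy3 ε u A Ω with hF
  have hF' : 2 * F = ∫ x in Ω, energyDensity3 ε u A x := by
    rw [hF, freeEnergy3]
    simp only [energyDensity3]
    ring
  have hF0 : 0 ≤ F := by
    have : 0 ≤ ∫ x in Ω, energyDensity3 ε u A x :=
      integral_nonneg fun x => energyDensity3_nonneg ε u A x
    linarith
  set V := Ω ∩ (fun x => ‖u x‖) ⁻¹' Ioo (1 / 2) (4 / 5) with hV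
  have hVo : IsOpen V := hu'.continuousOn.norm.isOpen_inter_preimage hΩ isOpen_Ioo
  have hVfin : μH[2 + 1] V ≠ ∞ := by
    rw [hκ, Measure.smul_apply]
    exact ENNReal.mul_ne_top ENNReal.coe_ne_top (hb.subset inter_subset_left).measure_lt_top.ne
  obtain ⟨g, hgm, hg, hgi⟩ := exists_measurable_hausdorffMeasure_fiber_le_lintegral (d := 2)
    two_pos (f := fun x => ‖u x‖)
    (h := fun x => ENNReal.ofReal (20 * ε * energyDensity3 ε u A x)) hVo.measurableSet hVfin (by
      intro x hx
      have hux : u x ≠ 0 := by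
        intro h0
        have := hx.2.1
        norm_num [h0] at this
      obtain ⟨L', hL', hnorm⟩ := ((hu'.contDiffAt (hΩ.mem_nhds hx.1)).hasStrictFDerivAt
        one_ne_zero).exists_norm_le_sum_covariant hux (A x)
      obtain ⟨c, hc1, hc2⟩ := exists_between
        (hnorm.trans_lt (sum_lt_mul_energyDensity3 hε hx.2.2 A))
      have hc0 : 0 ≤ c := (norm_nonneg _).trans hc1.le
      obtain ⟨U, hU, hLip⟩ := hL'.exists_lipschitzOnWith_of_nnnorm_lt (.mk c hc0) hc1
      have hev : ∀ᶠ y in 𝓝 x, c < 20 * ε * energyDensity3 ε u A y :=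
        ((hcont.continuousAt (hΩ.mem_nhds hx.1)).const_mul (20 * ε)).eventually_const_lt hc2
      refine ⟨_, inter_mem hU hev, .mk c hc0, hLip.mono inter_subset_left, fun y hy => ?_⟩
      rw [← ENNReal.ofReal_eq_coe_nnreal hc0]
      exact ENNReal.ofReal_le_ofReal (le_of_lt hy.2))
  have hgF : ∫⁻ t, g t ≤ ENNReal.ofReal (40 * κ * ε * F) := by
    refine hgi.trans ?_
    rw [hκ, Measure.restrict_smul, lintegral_smul_measure]
    have h1 : ∫⁻ x in V, ENNReal.ofReal (20 * ε * energyDensity3 ε u A x) ≤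
        ENNReal.ofReal (40 * ε * F) := by
      refine (lintegral_mono_set inter_subset_left).trans (le_of_eq ?_)
      rw [← ofReal_integral_eq_lintegral_ofReal (hint.const_mul _)
        (.of_forall fun x => mul_nonneg (by positivity) (energyDensity3_nonneg ε u A x)),
        integral_const_mul, ← hF']
      congr 1
      ring
    refine (mul_le_mul_right h1 _).trans (le_of_eq ?_)
    rw [← ENNReal.ofReal_coe_nnreal, ← ENNReal.ofReal_mul κ.coe_nonneg]
    congr 1
    ring
  have hεα : 0 < ε ^ α := Real.rpow_pos_of_pos hε α
  have hbad : volume {t | ENNReal.ofReal (ε ^ α) ≤ g t} ≤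
      ENNReal.ofReal ((40 * κ + 1) * ε ^ (1 - α) * F) := by
    have h1 := (mul_meas_ge_le_lintegral (μ := volume) hgm (ENNReal.ofReal (ε ^ α))).trans hgF
    rw [mul_comm, ← ENNReal.le_div_iff_mul_le (.inl (by simpa using hεα))
      (.inl ENNReal.ofReal_ne_top), ← ENNReal.ofReal_div_of_pos hεα] at h1
    refine h1.trans (ENNReal.ofReal_le_ofReal ?_)
    have h2 : 40 * κ * ε * F / ε ^ α = 40 * κ * ε ^ (1 - α) * F := by
      rw [Real.rpow_sub hε, Real.rpow_one]
      ring
    rw [h2]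
    gcongr
    linarith
  have hsub : Icc (5 / 8 : ℝ) (3 / 4) ⊆
      {t : ℝ | t ∈ Icc (5 / 8 : ℝ) (3 / 4) ∧
        μH[2] {x ∈ Ω | ‖u x‖ = t} ≤ ENNReal.ofReal (ε ^ α)} ∪
      {t | ENNReal.ofReal (ε ^ α) ≤ g t} := by
    intro t ht
    rcases le_total (g t) (ENNReal.ofReal (ε ^ α)) with h | h
    · refine .inl ⟨ht, le_trans (measure_mono ?_) ((hg t).trans h)⟩
      rintro x ⟨hx, hxt⟩
      refine ⟨⟨hx, ?_⟩, hxt⟩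
      change ‖u x‖ ∈ Ioo _ _
      rw [hxt]
      exact ⟨by linarith [ht.1], by linarith [ht.2]⟩
    · exact .inr h
  rw [ENNReal.ofReal_sub _ (by positivity), tsub_le_iff_right]
  calc ENNReal.ofReal (1 / 8) = volume (Icc (5 / 8 : ℝ) (3 / 4)) := by
        rw [Real.volume_Icc]
        norm_num
    _ ≤ _ := measure_mono hsub
    _ ≤ _ := measure_union_le _ _
    _ ≤ _ := by gcongr
end
end
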